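/- arXiv:2504.02749 — 2 statements merged into one kernel-verified Lean document; each statement's English description precedes it below -/
import Mathlib

section
/- The symplectic form ω restricted to the check span G has rank 2·(m−1)·(n−1); equivalently, dim G minus the dimension of the radical {v ∈ G : ∀ w ∈ G, ω(v,w) = 0} equals 2·(m−1)·(n−1). (This is the statement that the Bacon-Shor code on an m×n grid has (m−1)·(n−1) gauge qubits.) -/
open Finset

/-- The F₂-vector space of Pauli operators (mod phase) on the m×n grid:
first component is the X-support, second the Z-support. -/
abbrev V (m n : ℕ) := ((Fin m × Fin n) → ZMod 2) × ((Fin m × Fin n) → ZMod 2)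

/-- Symplectic form: two Paulis commute iff `omega` of their vectors is 0. -/
def omega {m n : ℕ} (v w : V m n) : ZMod 2 :=
  ∑ q : Fin m × Fin n, (v.1 q * w.2 q + w.1 q * v.2 q)

/-- Horizontal XX check H(i,j): X-part the indicator of {(i,j),(i+1,j)}
(here i ranges over Fin (m-1), i.e. 0 ≤ i ≤ m−2). -/
def Hcheck {m n : ℕ} (i : Fin (m - 1)) (j : Fin n) : V m n :=
  (fun q => if (q.1.val = i.val ∨ q.1.val = i.val + 1) ∧ q.2 = j then 1 else 0, 0)

/-- Vertical ZZ check W(i,j): Z-part the indicator of {(i,j),(i,j+1)}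
(here j ranges over Fin (n-1), i.e. 0 ≤ j ≤ n−2). -/
def Wcheck {m n : ℕ} (i : Fin m) (j : Fin (n - 1)) : V m n :=
  (0, fun q => if q.1 = i ∧ (q.2.val = j.val ∨ q.2.val = j.val + 1) then 1 else 0)

/-- The F₂-span G of all Bacon-Shor check vectors. -/
def checkSpan (m n : ℕ) : Submodule (ZMod 2) (V m n) :=
  Submodule.span (ZMod 2)
    ((Set.range fun p : Fin (m - 1) × Fin n => Hcheck p.1 p.2) ∪
     (Set.range fun p : Fin m × Fin (n - 1) => Wcheck p.1 p.2))

/-- `omega · w` as a linear map in the first argument. -/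
def omegaR {m n : ℕ} (w : V m n) : V m n →ₗ[ZMod 2] ZMod 2 where
  toFun v := omega v w
  map_add' a b := by
    simp only [omega, Prod.fst_add, Prod.snd_add, Pi.add_apply]
    rw [← Finset.sum_add_distrib]
    exact Finset.sum_congr rfl fun q _ => by ring
  map_smul' c a := by
    simp only [omega, Prod.smul_fst, Prod.smul_snd, Pi.smul_apply, smul_eq_mul,
      RingHom.id_apply, Finset.mul_sum]
    exact Finset.sum_congr rfl fun q _ => by ring

/-- The radical {v ∈ G : ∀ w ∈ G, ω(v,w) = 0} of the symplectic form on G. -/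
def radical (m n : ℕ) : Submodule (ZMod 2) (V m n) :=
  checkSpan m n ⊓ ⨅ w ∈ checkSpan m n, LinearMap.ker (omegaR w)

/-- The centralizer {v ∈ V : ∀ w ∈ G, ω(v,w) = 0} of the check span. -/
def centralizer (m n : ℕ) : Submodule (ZMod 2) (V m n) :=
  ⨅ w ∈ checkSpan m n, LinearMap.ker (omegaR w)

/-- Vertical X-type stabilizer S^X_i (i = 1,…,m−1 encoded as Fin (m-1) via i ↦ i−1):
X-part the indicator of {i−1,i} × Fin n. -/
def SX {m n : ℕ} (i : Fin (m - 1)) : V m n :=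
  (fun q => if q.1.val = i.val ∨ q.1.val = i.val + 1 then 1 else 0, 0)

/-- Horizontal Z-type stabilizer S^Z_j (j = 1,…,n−1 encoded as Fin (n-1) via j ↦ j−1):
Z-part the indicator of Fin m × {j−1,j}. -/
def SZ {m n : ℕ} (j : Fin (n - 1)) : V m n :=
  (0, fun q => if q.2.val = j.val ∨ q.2.val = j.val + 1 then 1 else 0)

/-- Logical X̄_L: X-part the indicator of {0} × Fin n. -/
def XL {m n : ℕ} : V m n :=
  (fun q => if q.1.val = 0 then 1 else 0, 0)

/-- Logical Z̄_L: Z-part the indicator of Fin m × {0}. -/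
def ZL {m n : ℕ} : V m n :=
  (0, fun q => if q.2.val = 0 then 1 else 0)

/-- Gauge qubit X̄_{a,b} (1 ≤ a ≤ m−1, 1 ≤ b ≤ n−1, encoded as Fin (m-1) × Fin (n-1)
via (a,b) ↦ (a−1,b−1)): X-part the indicator of {a−1,a} × {b,…,n−1}. -/
def gaugeX {m n : ℕ} (a : Fin (m - 1)) (b : Fin (n - 1)) : V m n :=
  (fun q => if (q.1.val = a.val ∨ q.1.val = a.val + 1) ∧ b.val + 1 ≤ q.2.val then 1 else 0, 0)

/-- Gauge qubit Z̄_{a,b}: Z-part the indicator of {a,…,m−1} × {b−1,b}. -/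
def gaugeZ {m n : ℕ} (a : Fin (m - 1)) (b : Fin (n - 1)) : V m n :=
  (0, fun q => if a.val + 1 ≤ q.1.val ∧ (q.2.val = b.val ∨ q.2.val = b.val + 1) then 1 else 0)

/-- Destabilizer D^X_j: X-part the indicator of {0} × {j,…,n−1}. -/
def DX {m n : ℕ} (j : Fin (n - 1)) : V m n :=
  (fun q => if q.1.val = 0 ∧ j.val + 1 ≤ q.2.val then 1 else 0, 0)

/-- Destabilizer D^Z_i: Z-part the indicator of {i,…,m−1} × {0}. -/
def DZ {m n : ℕ} (i : Fin (m - 1)) : V m n :=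
  (0, fun q => if i.val + 1 ≤ q.1.val ∧ q.2.val = 0 then 1 else 0)


section BaconShor

variable {m n : ℕ}

/-- The indicator of `{i, i + 1}`. -/
def pairInd (i x : ℕ) : ZMod 2 := if x = i ∨ x = i + 1 then 1 else 0

/-- The indicator of `{k, k + 1, …}`. -/
def tailInd (k x : ℕ) : ZMod 2 := if k ≤ x then 1 else 0

/-- The X-type vector whose support function is the product of `f` and `g`. -/
def prodX (f g : ℕ → ZMod 2) : V m n := (fun q => f q.1 * g q.2, 0)

/-- The Z-type vector whose support function is the product of `f` and `g`. -/
def prodZ (f g : ℕ → ZMod 2) : V m n := (0, fun q => f q.1 * g q.2)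

theorem omega_comm (v w : V m n) : omega v w = omega w v :=
  Finset.sum_congr rfl fun _ _ => add_comm _ _

theorem omega_prodX_prodX (f g f' g' : ℕ → ZMod 2) :
    omega (prodX f g : V m n) (prodX f' g') = 0 := by
  simp [omega, prodX]

theorem omega_prodZ_prodZ (f g f' g' : ℕ → ZMod 2) :
    omega (prodZ f g : V m n) (prodZ f' g') = 0 := by
  simp [omega, prodZ]

theorem omega_prodX_prodZ (f g f' g' : ℕ → ZMod 2) :
    omega (prodX f g : V m n) (prodZ f' g') =
      (∑ i : Fin m, f i * f' i) * ∑ j : Fin n, g j * g' j := by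
  simp only [omega, prodX, prodZ, Pi.zero_apply, mul_zero, add_zero]
  rw [Fintype.sum_prod_type, Finset.sum_mul_sum]
  exact Finset.sum_congr rfl fun _ _ => Finset.sum_congr rfl fun _ _ => by ring

theorem sum_pairInd_mul (i : Fin (m - 1)) (f : ℕ → ZMod 2) :
    ∑ x : Fin m, pairInd i x * f x = f i + f (i + 1) := by
  have hi : i.val < m := by omega
  have hi' : i.val + 1 < m := by omega
  have h : ∀ x : Fin m, pairInd i x * f x =
      (if x = ⟨i, hi⟩ then f x else 0) + if x = ⟨i + 1, hi'⟩ then f x else 0 := by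
    intro x
    simp only [pairInd, Fin.ext_iff]
    split_ifs <;> first | omega | simp
  simp [h, Finset.sum_add_distrib]

theorem sum_mul_pairInd (i : Fin (m - 1)) (f : ℕ → ZMod 2) :
    ∑ x : Fin m, f x * pairInd i x = f i + f (i + 1) := by
  simp only [mul_comm (f _), sum_pairInd_mul]

theorem tailInd_succ_add (a i : ℕ) :
    tailInd (a + 1) i + tailInd (a + 1) (i + 1) = if a = i then 1 else 0 := by
  simp only [tailInd]
  split_ifs <;> first | omega | rfl

theorem tailInd_zero_add (i : ℕ) : tailInd 0 i + tailInd 0 (i + 1) = 0 := by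
  simp only [tailInd, Nat.zero_le, if_true]
  rfl

theorem tailInd_add_succ (j x : ℕ) :
    tailInd j x + tailInd (j + 1) x = if x = j then 1 else 0 := by
  simp only [tailInd]
  split_ifs <;> first | omega | rfl

theorem Hcheck_eq (i : Fin (m - 1)) (j : Fin n) :
    (Hcheck i j : V m n) =
      prodX (pairInd i) (tailInd j) + prodX (pairInd i) (tailInd (j + 1)) := by
  refine Prod.ext (funext fun q => ?_) (by simp [Hcheck, prodX])
  simp only [Hcheck, prodX, Prod.fst_add, Pi.add_apply, ← mul_add, tailInd_add_succ, pairInd,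
    Fin.ext_iff, ite_and, mul_ite, mul_one, mul_zero]
  split_ifs <;> rfl

theorem Wcheck_eq (i : Fin m) (j : Fin (n - 1)) :
    (Wcheck i j : V m n) =
      prodZ (tailInd i) (pairInd j) + prodZ (tailInd (i + 1)) (pairInd j) := by
  refine Prod.ext (by simp [Wcheck, prodZ]) (funext fun q => ?_)
  simp only [Wcheck, prodZ, Prod.snd_add, Pi.add_apply, ← add_mul, tailInd_add_succ, pairInd,
    Fin.ext_iff, ite_and, ite_mul, one_mul, zero_mul]

theorem prodX_pairInd_tailInd_mem (i : Fin (m - 1)) (k : ℕ) :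
    prodX (pairInd i) (tailInd k) ∈ checkSpan m n := by
  have h : (prodX (pairInd i) (tailInd k) : V m n) =
      ∑ j : Fin n, tailInd k j • Hcheck i j := by
    refine Prod.ext (funext fun q => ?_) (by simp [Hcheck, prodX, Prod.snd_sum])
    simp [Hcheck, prodX, pairInd, Prod.fst_sum, Finset.sum_apply, ite_and]
  rw [h]
  exact Submodule.sum_mem _ fun j _ => Submodule.smul_mem _ _ <|
    Submodule.subset_span <| Or.inl ⟨(i, j), rfl⟩

theorem prodZ_tailInd_pairInd_mem (k : ℕ) (j : Fin (n - 1)) :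
    prodZ (tailInd k) (pairInd j) ∈ checkSpan m n := by
  have h : (prodZ (tailInd k) (pairInd j) : V m n) =
      ∑ i : Fin m, tailInd k i • Wcheck i j := by
    refine Prod.ext (by simp [Wcheck, prodZ, Prod.fst_sum]) (funext fun q => ?_)
    simp [Wcheck, prodZ, pairInd, Prod.snd_sum, Finset.sum_apply, ite_and]
  rw [h]
  exact Submodule.sum_mem _ fun i _ => Submodule.smul_mem _ _ <|
    Submodule.subset_span <| Or.inr ⟨(i, j), rfl⟩

theorem omega_add_left (u v w : V m n) : omega (u + v) w = omega u w + omega v w :=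
  (omegaR w).map_add u v

theorem omega_add_right (u v w : V m n) : omega u (v + w) = omega u v + omega u w := by
  simp only [omega_comm u, omega_add_left]

/-- A vector commuting with every check commutes with the whole check span. -/
theorem omega_eq_zero_of_checks {v : V m n}
    (hH : ∀ i j, omega v (Hcheck i j) = 0) (hW : ∀ i j, omega v (Wcheck i j) = 0)
    {w : V m n} (hw : w ∈ checkSpan m n) : omega v w = 0 := by
  have h : checkSpan m n ≤ LinearMap.ker (omegaR v) := by
    refine Submodule.span_le.2 ?_
    rintro _ (⟨p, rfl⟩ | ⟨p, rfl⟩)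
    · exact (omega_comm _ _).trans (hH p.1 p.2)
    · exact (omega_comm _ _).trans (hW p.1 p.2)
  exact (omega_comm _ _).trans (h hw)

theorem omega_prodX_tailInd_zero (i : Fin (m - 1)) {w : V m n} (hw : w ∈ checkSpan m n) :
    omega w (prodX (pairInd i) (tailInd 0)) = 0 := by
  rw [omega_comm]
  refine omega_eq_zero_of_checks (fun _ _ => ?_) (fun _ _ => ?_) hw
  · simp only [Hcheck_eq, omega_add_right, omega_prodX_prodX, add_zero]
  · simp only [Wcheck_eq, omega_add_right, omega_prodX_prodZ, sum_mul_pairInd,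
      tailInd_zero_add, mul_zero, add_zero]

theorem omega_prodZ_tailInd_zero (j : Fin (n - 1)) {w : V m n} (hw : w ∈ checkSpan m n) :
    omega w (prodZ (tailInd 0) (pairInd j)) = 0 := by
  rw [omega_comm]
  refine omega_eq_zero_of_checks (fun _ _ => ?_) (fun _ _ => ?_) hw
  · rw [omega_comm]
    simp only [Hcheck_eq, omega_add_left, omega_prodX_prodZ, sum_pairInd_mul,
      tailInd_zero_add, zero_mul, add_zero]
  · simp only [Wcheck_eq, omega_add_right, omega_prodZ_prodZ, add_zero]

theorem prodX_tailInd_of_le (f : ℕ → ZMod 2) {k : ℕ} (hk : n ≤ k) :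
    (prodX f (tailInd k) : V m n) = 0 := by
  refine Prod.ext (funext fun q => ?_) rfl
  have : ¬ k ≤ q.2.val := by omega
  simp [prodX, tailInd, this]

theorem prodZ_tailInd_of_le (g : ℕ → ZMod 2) {k : ℕ} (hk : m ≤ k) :
    (prodZ (tailInd k) g : V m n) = 0 := by
  refine Prod.ext rfl (funext fun q => ?_)
  have : ¬ k ≤ q.1.val := by omega
  simp [prodZ, tailInd, this]

/-- The X-type operator of the gauge qubit indexed by `p`. -/
def gaugeVecX (p : Fin (m - 1) × Fin (n - 1)) : V m n := prodX (pairInd p.1) (tailInd (p.2 + 1))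

/-- The Z-type operator of the gauge qubit indexed by `p`. -/
def gaugeVecZ (p : Fin (m - 1) × Fin (n - 1)) : V m n := prodZ (tailInd (p.1 + 1)) (pairInd p.2)

theorem omega_gaugeVecX_gaugeVecZ (p q : Fin (m - 1) × Fin (n - 1)) :
    omega (gaugeVecX p) (gaugeVecZ q) = if p = q then 1 else 0 := by
  simp only [gaugeVecX, gaugeVecZ, omega_prodX_prodZ, sum_pairInd_mul, sum_mul_pairInd,
    tailInd_succ_add, Prod.ext_iff, Fin.ext_iff, eq_comm (a := q.1.val)]
  split_ifs <;> simp_all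

theorem omega_gaugeVecX_gaugeVecX (p q : Fin (m - 1) × Fin (n - 1)) :
    omega (gaugeVecX p) (gaugeVecX q) = 0 := omega_prodX_prodX _ _ _ _

theorem omega_gaugeVecZ_gaugeVecZ (p q : Fin (m - 1) × Fin (n - 1)) :
    omega (gaugeVecZ p) (gaugeVecZ q) = 0 := omega_prodZ_prodZ _ _ _ _

theorem gaugeVecX_mem (p : Fin (m - 1) × Fin (n - 1)) : gaugeVecX p ∈ checkSpan m n :=
  prodX_pairInd_tailInd_mem _ _

theorem gaugeVecZ_mem (p : Fin (m - 1) × Fin (n - 1)) : gaugeVecZ p ∈ checkSpan m n :=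
  prodZ_tailInd_pairInd_mem _ _

/-- The commutation syndrome of a vector of the check span against all gauge operators. -/
def gaugeSyndrome (m n : ℕ) : checkSpan m n →ₗ[ZMod 2]
    (Fin (m - 1) × Fin (n - 1) → ZMod 2) × (Fin (m - 1) × Fin (n - 1) → ZMod 2) :=
  ((LinearMap.pi fun p => omegaR (gaugeVecZ p)).prod
    (LinearMap.pi fun p => omegaR (gaugeVecX p))) ∘ₗ (checkSpan m n).subtype

theorem gaugeSyndrome_surjective : Function.Surjective (gaugeSyndrome m n) := by
  rintro ⟨f, g⟩
  refine ⟨⟨∑ p, f p • gaugeVecX p + ∑ p, g p • gaugeVecZ p, ?_⟩, ?_⟩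
  · exact Submodule.add_mem _
      (Submodule.sum_mem _ fun p _ => Submodule.smul_mem _ _ (gaugeVecX_mem p))
      (Submodule.sum_mem _ fun p _ => Submodule.smul_mem _ _ (gaugeVecZ_mem p))
  · have hR (v w : V m n) : omegaR w v = omega v w := rfl
    refine Prod.ext (funext fun q => ?_) (funext fun q => ?_)
    · change omegaR (gaugeVecZ q) (∑ p, f p • gaugeVecX p + ∑ p, g p • gaugeVecZ p) = f q
      simp only [map_add, map_sum, map_smul]
      simp [hR, omega_gaugeVecX_gaugeVecZ, omega_gaugeVecZ_gaugeVecZ]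
    · change omegaR (gaugeVecX q) (∑ p, f p • gaugeVecX p + ∑ p, g p • gaugeVecZ p) = g q
      simp only [map_add, map_sum, map_smul]
      simp [hR, omega_comm (gaugeVecZ _) (gaugeVecX q), omega_gaugeVecX_gaugeVecZ,
        omega_gaugeVecX_gaugeVecX]

theorem mem_radical {v : V m n} :
    v ∈ radical m n ↔ v ∈ checkSpan m n ∧ ∀ w ∈ checkSpan m n, omega v w = 0 := by
  simp only [radical, Submodule.mem_inf, Submodule.mem_iInf, LinearMap.mem_ker]
  rfl

theorem omega_prodX_of_gaugeVecX {v : V m n} (hv : v ∈ checkSpan m n)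
    (h : ∀ p, omega v (gaugeVecX p) = 0) (i : Fin (m - 1)) (k : ℕ) :
    omega v (prodX (pairInd i) (tailInd k)) = 0 := by
  rcases k with _ | k
  · exact omega_prodX_tailInd_zero i hv
  by_cases hk : k < n - 1
  · exact h (i, ⟨k, hk⟩)
  · rw [prodX_tailInd_of_le _ (by omega), omega_comm]
    exact (omegaR v).map_zero

theorem omega_prodZ_of_gaugeVecZ {v : V m n} (hv : v ∈ checkSpan m n)
    (h : ∀ p, omega v (gaugeVecZ p) = 0) (k : ℕ) (j : Fin (n - 1)) :
    omega v (prodZ (tailInd k) (pairInd j)) = 0 := by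
  rcases k with _ | k
  · exact omega_prodZ_tailInd_zero j hv
  by_cases hk : k < m - 1
  · exact h (⟨k, hk⟩, j)
  · rw [prodZ_tailInd_of_le _ (by omega), omega_comm]
    exact (omegaR v).map_zero

theorem ker_gaugeSyndrome :
    LinearMap.ker (gaugeSyndrome m n) = (radical m n).comap (checkSpan m n).subtype := by
  ext ⟨v, hv⟩
  simp only [LinearMap.mem_ker, Submodule.mem_comap, Submodule.subtype_apply, mem_radical]
  constructor
  · intro h
    have hZ : ∀ p, omega v (gaugeVecZ p) = 0 := fun p => congrFun (congrArg Prod.fst h) p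
    have hX : ∀ p, omega v (gaugeVecX p) = 0 := fun p => congrFun (congrArg Prod.snd h) p
    refine ⟨hv, fun w hw => omega_eq_zero_of_checks (fun i j => ?_) (fun i j => ?_) hw⟩
    · simp only [Hcheck_eq, omega_add_right, omega_prodX_of_gaugeVecX hv hX, add_zero]
    · simp only [Wcheck_eq, omega_add_right, omega_prodZ_of_gaugeVecZ hv hZ, add_zero]
  · rintro ⟨-, h⟩
    exact Prod.ext (funext fun p => h _ (gaugeVecZ_mem p))
      (funext fun p => h _ (gaugeVecX_mem p))

end BaconShor

/-- The symplectic form restricted to G has rank 2·(m−1)·(n−1): dim G minus the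
dimension of the radical equals 2·(m−1)·(n−1) (i.e. (m−1)·(n−1) gauge qubits). -/
theorem stmt4 (m n : ℕ) (hm : 2 ≤ m) (hn : 2 ≤ n) :
    Module.finrank (ZMod 2) ↥(checkSpan m n) - Module.finrank (ZMod 2) ↥(radical m n) =
      2 * (m - 1) * (n - 1) := by
  have h := (gaugeSyndrome m n).finrank_range_add_finrank_ker
  rw [LinearMap.range_eq_top.2 gaugeSyndrome_surjective, finrank_top, ker_gaugeSyndrome,
    (Submodule.comapSubtypeEquivOfLe (p := radical m n) inf_le_left).finrank_eq] at h
  rw [← h, Nat.add_sub_cancel]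
  simp only [Module.finrank_prod, Module.finrank_fintype_fun_eq_card, Fintype.card_prod,
    Fintype.card_fin]
  ring
end

section
/- The centralizer of the check span, namely the subspace {v ∈ V : ∀ w ∈ G, ω(v,w) = 0}, has F₂-dimension m + n. (Together with the radical having dimension m+n−2, this yields exactly one logical qubit for the Bacon-Shor code.) -/
open Finset

theorem mem_centralizer_iff_checks {m n : ℕ} (v : V m n) :
    v ∈ centralizer m n ↔
      (∀ i j, omega v (Hcheck i j) = 0) ∧ ∀ i j, omega v (Wcheck i j) = 0 := by
  have omega_symm : ∀ v w : V m n, omega v w = omega w v := fun v w =>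
    Finset.sum_congr rfl fun q _ => by ring
  simp only [centralizer, Submodule.mem_iInf, LinearMap.mem_ker]
  change (∀ w ∈ checkSpan m n, omega v w = 0) ↔ _
  constructor
  · intro h
    exact ⟨fun i j => h _ (Submodule.subset_span (Or.inl ⟨(i, j), rfl⟩)),
      fun i j => h _ (Submodule.subset_span (Or.inr ⟨(i, j), rfl⟩))⟩
  · rintro ⟨hH, hW⟩ w hw
    rw [omega_symm]
    have hle : checkSpan m n ≤ LinearMap.ker (omegaR v) := by
      refine Submodule.span_le.2 ?_
      rintro _ (⟨p, rfl⟩ | ⟨p, rfl⟩)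
      · exact (omega_symm _ _).trans (hH p.1 p.2)
      · exact (omega_symm _ _).trans (hW p.1 p.2)
    exact hle hw

theorem sum_indicator_pair {α : Type*} [Fintype α] [DecidableEq α] (f : α → ZMod 2)
    (p : α → Prop) [DecidablePred p] {a b : α} (hab : a ≠ b) (hp : ∀ q, p q ↔ q = a ∨ q = b) :
    ∑ q, f q * (if p q then 1 else 0) = f a + f b := by
  have hs : (univ.filter p) = {a, b} := by
    ext q
    simp [hp]
  simp only [mul_ite, mul_one, mul_zero]
  rw [← Finset.sum_filter, hs, Finset.sum_pair hab]

theorem omega_Hcheck {m n : ℕ} (v : V m n) (i : Fin (m - 1)) (j : Fin n) :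
    omega v (Hcheck i j) =
      v.2 (⟨i, by omega⟩, j) + v.2 (⟨i + 1, by omega⟩, j) := by
  rw [← sum_indicator_pair v.2
    (fun q => (q.1.val = i.val ∨ q.1.val = i.val + 1) ∧ q.2 = j) (by simp)]
  · simp [omega, Hcheck, mul_comm]
  · rintro ⟨a, b⟩
    simp only [Prod.mk.injEq, Fin.ext_iff]
    tauto

theorem omega_Wcheck {m n : ℕ} (v : V m n) (i : Fin m) (j : Fin (n - 1)) :
    omega v (Wcheck i j) =
      v.1 (i, ⟨j, by omega⟩) + v.1 (i, ⟨j + 1, by omega⟩) := by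
  rw [← sum_indicator_pair v.1
    (fun q => q.1 = i ∧ (q.2.val = j.val ∨ q.2.val = j.val + 1)) (by simp)]
  · simp [omega, Wcheck]
  · rintro ⟨a, b⟩
    simp only [Prod.mk.injEq, Fin.ext_iff]
    tauto

theorem eq_apply_zero_of_adjacent_eq {α : Type*} {n : ℕ} (hn : 0 < n) (f : Fin n → α)
    (h : ∀ j : Fin (n - 1), f ⟨j, by omega⟩ = f ⟨j + 1, by omega⟩) (j : Fin n) :
    f j = f ⟨0, hn⟩ := by
  obtain ⟨k, hk⟩ := j
  induction k with
  | zero => rfl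
  | succ k ih => exact (h ⟨k, by omega⟩).symm.trans (ih (by omega))

/-- The Pauli operator whose X-support is a union of rows of constant first coordinate and whose
Z-support is a union of lines of constant second coordinate. -/
def lineOperator (m n : ℕ) : ((Fin m → ZMod 2) × (Fin n → ZMod 2)) →ₗ[ZMod 2] V m n :=
  (LinearMap.funLeft (ZMod 2) (ZMod 2) Prod.fst).prodMap
    (LinearMap.funLeft (ZMod 2) (ZMod 2) Prod.snd)

theorem lineOperator_injective {m n : ℕ} (hm : 0 < m) (hn : 0 < n) :
    Function.Injective (lineOperator m n) := by
  intro x y h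
  ext i
  · exact congrFun (congrArg Prod.fst h) (i, ⟨0, hn⟩)
  · exact congrFun (congrArg Prod.snd h) (⟨0, hm⟩, i)

theorem range_lineOperator {m n : ℕ} (hm : 0 < m) (hn : 0 < n) :
    LinearMap.range (lineOperator m n) = centralizer m n := by
  ext v
  simp only [mem_centralizer_iff_checks, omega_Hcheck, omega_Wcheck, CharTwo.add_eq_zero]
  constructor
  · rintro ⟨x, rfl⟩
    exact ⟨fun _ _ => rfl, fun _ _ => rfl⟩
  · rintro ⟨hH, hW⟩
    refine ⟨(fun i => v.1 (i, ⟨0, hn⟩), fun j => v.2 (⟨0, hm⟩, j)), Prod.ext ?_ ?_⟩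
    · funext q
      exact (eq_apply_zero_of_adjacent_eq hn (fun j => v.1 (q.1, j)) (hW q.1) q.2).symm
    · funext q
      exact (eq_apply_zero_of_adjacent_eq hm (fun i => v.2 (i, q.2)) (fun i => hH i q.2) q.1).symm

/-- The centralizer {v ∈ V : ∀ w ∈ G, ω(v,w) = 0} of the check span has
F₂-dimension m + n. -/
theorem stmt5 (m n : ℕ) (hm : 2 ≤ m) (hn : 2 ≤ n) :
    Module.finrank (ZMod 2) ↥(centralizer m n) = m + n := by
  rw [← range_lineOperator (by omega) (by omega),
    LinearMap.finrank_range_of_inj (lineOperator_injective (by omega) (by omega))]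
  simp
end
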